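/- Let u be an infinite word over a three-letter alphabet whose language is closed under reversal. Then: (1) if the factor complexity of u satisfies C(n) = 2n + 1 for all n ∈ ℕ, then the palindromic complexity satisfies P(n) + P(n+1) = 4 for all n ∈ ℕ; (2) if every bispecial factor of u is ordinary, then every palindromic factor of u has exactly one palindromic extension. -/

import Mathlib

open List

/-- The factor of `u` of length `n` starting at position `i`. -/
def word {A : Type*} (u : ℕ → A) (i n : ℕ) : List A :=
  (List.range n).map (fun j => u (i + j))

/-- `w` occurs in `u` at position `i`. -/
def OccursAt {A : Type*} (u : ℕ → A) (w : List A) (i : ℕ) : Prop :=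
  w = word u i w.length

/-- `w` is a factor of the infinite word `u`. -/
def IsFactor {A : Type*} (u : ℕ → A) (w : List A) : Prop :=
  ∃ i, OccursAt u w i

/-- Every letter of the alphabet occurs in `u`. -/
def AllLettersOccur {A : Type*} (u : ℕ → A) : Prop :=
  ∀ a : A, ∃ i, u i = a

/-- The language of `u` is closed under reversal. -/
def ClosedUnderReversal {A : Type*} (u : ℕ → A) : Prop :=
  ∀ w : List A, IsFactor u w → IsFactor u w.reverse

/-- `u` is uniformly recurrent: every factor occurs in every window of some
bounded length. -/
def UniformlyRecurrent {A : Type*} (u : ℕ → A) : Prop :=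
  ∀ w : List A, IsFactor u w → ∃ N : ℕ, ∀ i : ℕ, ∃ j : ℕ,
    i ≤ j ∧ j < i + N ∧ OccursAt u w j

/-- Factor complexity: the number of factors of `u` of length `n`. -/
noncomputable def complexity {A : Type*} (u : ℕ → A) (n : ℕ) : ℕ :=
  Set.ncard {w : List A | w.length = n ∧ IsFactor u w}

/-- Palindromic complexity: the number of palindromic factors of `u` of
length `n`. -/
noncomputable def palComplexity {A : Type*} (u : ℕ → A) (n : ℕ) : ℕ :=
  Set.ncard {w : List A | w.length = n ∧ IsFactor u w ∧ w.reverse = w}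

/-- The number of distinct palindromic factors of a finite word
(the empty word included). -/
noncomputable def palCount {A : Type*} (w : List A) : ℕ :=
  Set.ncard {v : List A | v <:+: w ∧ v.reverse = v}

/-- `u` is rich in palindromes. -/
def Rich {A : Type*} (u : ℕ → A) : Prop :=
  ∀ w : List A, IsFactor u w → palCount w = w.length + 1

/-- `j < k` are two successive occurrences of `w` in `u`. -/
def SuccOccurrences {A : Type*} (u : ℕ → A) (w : List A) (j k : ℕ) : Prop :=
  OccursAt u w j ∧ OccursAt u w k ∧ j < k ∧
    ∀ l : ℕ, j < l → l < k → ¬ OccursAt u w l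

/-- The set of return words of the factor `w` in `u`. -/
def returnWords {A : Type*} (u : ℕ → A) (w : List A) : Set (List A) :=
  {v | ∃ j k : ℕ, SuccOccurrences u w j k ∧ v = word u j (k - j)}

/-- Left extensions of `w` in `u`. -/
def Lext {A : Type*} (u : ℕ → A) (w : List A) : Set A :=
  {a | IsFactor u (a :: w)}

/-- Right extensions of `w` in `u`. -/
def Rext {A : Type*} (u : ℕ → A) (w : List A) : Set A :=
  {b | IsFactor u (w ++ [b])}

/-- Bilateral extensions of `w` in `u`. -/
def Bext {A : Type*} (u : ℕ → A) (w : List A) : Set (A × A) :=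
  {p | IsFactor u (p.1 :: (w ++ [p.2]))}

/-- Palindromic extensions of a (palindromic) factor `w` of `u`. -/
def Pext {A : Type*} (u : ℕ → A) (w : List A) : Set (List A) :=
  {v | ∃ a : A, v = a :: (w ++ [a]) ∧ IsFactor u v}

/-- `w` is a bispecial factor of `u`. -/
def Bispecial {A : Type*} (u : ℕ → A) (w : List A) : Prop :=
  IsFactor u w ∧ 2 ≤ Set.ncard (Lext u w) ∧ 2 ≤ Set.ncard (Rext u w)

/-- The bilateral order of a factor `w` of `u`. -/
noncomputable def bilateralOrder {A : Type*} (u : ℕ → A) (w : List A) : ℤ :=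
  (Set.ncard (Bext u w) : ℤ) - Set.ncard (Rext u w) - Set.ncard (Lext u w) + 1

/-- `u` is eventually periodic. -/
def EventuallyPeriodic {A : Type*} (u : ℕ → A) : Prop :=
  ∃ p : ℕ, 0 < p ∧ ∃ N : ℕ, ∀ n : ℕ, N ≤ n → u (n + p) = u n

/-- `u` is aperiodic. -/
def Aperiodic {A : Type*} (u : ℕ → A) : Prop :=
  ¬ EventuallyPeriodic u

/-- `u` is (1-)balanced. -/
def IsBalanced {A : Type*} [DecidableEq A] (u : ℕ → A) : Prop :=
  ∀ a : A, ∀ w v : List A, IsFactor u w → IsFactor u v → w.length = v.length →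
    |(w.count a : ℤ) - (v.count a : ℤ)| ≤ 1

open Classical in
/-- Finset of factors of length `n`. -/
noncomputable def FF {A : Type*} [Fintype A] (u : ℕ → A) (n : ℕ) : Finset (List A) :=
  ((List.finite_length_eq A n).subset
    (show {w : List A | w.length = n ∧ IsFactor u w} ⊆ {w | w.length = n} from
      fun _ h => h.1)).toFinset

open Classical in
/-- Finset of palindromic factors of length `n`. -/
noncomputable def PP {A : Type*} [Fintype A] (u : ℕ → A) (n : ℕ) : Finset (List A) :=
  (FF u n).filter (fun w => w.reverse = w)

open Classical in
noncomputable def rr {A : Type*} [Fintype A] (u : ℕ → A) (w : List A) : Finset A :=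
  Finset.univ.filter (fun b => IsFactor u (w ++ [b]))

open Classical in
noncomputable def ll {A : Type*} [Fintype A] (u : ℕ → A) (w : List A) : Finset A :=
  Finset.univ.filter (fun a => IsFactor u (a :: w))

open Classical in
noncomputable def bb {A : Type*} [Fintype A] (u : ℕ → A) (w : List A) : Finset (A × A) :=
  Finset.univ.filter (fun p => IsFactor u (p.1 :: (w ++ [p.2])))

open Classical in
noncomputable def dd {A : Type*} [Fintype A] (u : ℕ → A) (w : List A) : Finset A :=
  Finset.univ.filter (fun a => IsFactor u (a :: (w ++ [a])))

/-- Bilateral order, finset version. -/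
noncomputable def bo {A : Type*} [Fintype A] (u : ℕ → A) (w : List A) : ℤ :=
  ((bb u w).card : ℤ) - (rr u w).card - (ll u w).card + 1

section
variable {A : Type*} [Fintype A] {u : ℕ → A}

lemma mem_FF {n : ℕ} {w : List A} : w ∈ FF u n ↔ w.length = n ∧ IsFactor u w := by
  simp [FF]

lemma mem_PP {n : ℕ} {w : List A} :
    w ∈ PP u n ↔ w.length = n ∧ IsFactor u w ∧ w.reverse = w := by
  simp [PP, mem_FF, and_assoc]

lemma mem_rr {w : List A} {b : A} : b ∈ rr u w ↔ IsFactor u (w ++ [b]) := by simp [rr]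
lemma mem_ll {w : List A} {b : A} : b ∈ ll u w ↔ IsFactor u (b :: w) := by simp [ll]
lemma mem_bb {w : List A} {p : A × A} : p ∈ bb u w ↔ IsFactor u (p.1 :: (w ++ [p.2])) := by
  simp [bb]
lemma mem_dd {w : List A} {b : A} : b ∈ dd u w ↔ IsFactor u (b :: (w ++ [b])) := by simp [dd]

lemma complexity_eq (n : ℕ) : complexity u n = (FF u n).card := by
  rw [complexity, ← Set.ncard_coe_finset]
  congr 1; ext w; simp [mem_FF]

lemma palComplexity_eq (n : ℕ) : palComplexity u n = (PP u n).card := by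
  rw [palComplexity, ← Set.ncard_coe_finset]
  congr 1; ext w; simp [mem_PP]

lemma Rext_eq (w : List A) : (Rext u w).ncard = (rr u w).card := by
  rw [← Set.ncard_coe_finset]; congr 1; ext b; simp [mem_rr, Rext]

lemma Lext_eq (w : List A) : (Lext u w).ncard = (ll u w).card := by
  rw [← Set.ncard_coe_finset]; congr 1; ext b; simp [mem_ll, Lext]

lemma Bext_eq (w : List A) : (Bext u w).ncard = (bb u w).card := by
  rw [← Set.ncard_coe_finset]; congr 1; ext b; simp [mem_bb, Bext]

open Classical in
lemma Pext_eq (w : List A) : (Pext u w).ncard = (dd u w).card := by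
  rw [← Finset.card_image_of_injective (dd u w) (f := fun a => a :: (w ++ [a]))
    (fun a b h => by simpa using h), ← Set.ncard_coe_finset]
  congr 1; ext v; simp only [Pext, Set.mem_setOf_eq, Finset.coe_image, Set.mem_image,
    Finset.mem_coe, mem_dd]
  constructor
  · rintro ⟨a, rfl, h⟩; exact ⟨a, h, rfl⟩
  · rintro ⟨a, h, rfl⟩; exact ⟨a, rfl, h⟩

lemma bo_eq (w : List A) : bilateralOrder u w = bo u w := by
  rw [bilateralOrder, bo, Rext_eq, Lext_eq, Bext_eq]

lemma word_length (i n : ℕ) : (word u i n).length = n := by simp [word]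

lemma word_succ (i n : ℕ) : word u i (n+1) = word u i n ++ [u (i+n)] := by
  simp [word, List.range_succ]

lemma word_succ' (i n : ℕ) : word u i (n+1) = u i :: word u (i+1) n := by
  simp [word, List.range_succ_eq_map, Function.comp_def, Nat.add_comm, Nat.add_left_comm]

lemma isFactor_word (i n : ℕ) : IsFactor u (word u i n) :=
  ⟨i, by rw [OccursAt, word_length]⟩

lemma isFactor_iff {w : List A} : IsFactor u w ↔ ∃ i, word u i w.length = w := by
  simp [IsFactor, OccursAt, eq_comm]

lemma fac_init {w : List A} {b : A} (h : IsFactor u (w ++ [b])) : IsFactor u w := by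
  obtain ⟨i, hi⟩ := isFactor_iff.1 h
  rw [List.length_append, List.length_singleton, word_succ] at hi
  have := List.append_inj_left' hi rfl
  rw [← this]; exact isFactor_word _ _

lemma fac_tail {w : List A} {b : A} (h : IsFactor u (b :: w)) : IsFactor u w := by
  obtain ⟨i, hi⟩ := isFactor_iff.1 h
  rw [List.length_cons, word_succ'] at hi
  rw [← (List.cons.inj hi).2]; exact isFactor_word _ _

lemma fac_right {w : List A} (h : IsFactor u w) : ∃ b, IsFactor u (w ++ [b]) := by
  obtain ⟨i, hi⟩ := isFactor_iff.1 h
  refine ⟨u (i + w.length), ?_⟩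
  have := isFactor_word (u := u) i (w.length + 1)
  rwa [word_succ, hi] at this

lemma fac_rev (hc : ClosedUnderReversal u) {w : List A} : IsFactor u w.reverse ↔ IsFactor u w :=
  ⟨fun h => by simpa using hc _ h, hc w⟩

lemma fac_left (hc : ClosedUnderReversal u) {w : List A} (h : IsFactor u w) :
    ∃ a, IsFactor u (a :: w) := by
  obtain ⟨a, ha⟩ := fac_right (hc _ h)
  refine ⟨a, ?_⟩
  simpa using hc _ ha

lemma rr_pos {w : List A} (h : IsFactor u w) : 1 ≤ (rr u w).card := by
  obtain ⟨b, hb⟩ := fac_right h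
  exact Finset.card_pos.2 ⟨b, mem_rr.2 hb⟩

lemma ll_rev (hc : ClosedUnderReversal u) (w : List A) : ll u w.reverse = rr u w := by
  ext a; rw [mem_ll, mem_rr, ← fac_rev hc]; simp

lemma rr_rev (hc : ClosedUnderReversal u) (w : List A) : rr u w.reverse = ll u w := by
  ext a; rw [mem_ll, mem_rr, ← fac_rev hc]; simp

lemma bb_rev (hc : ClosedUnderReversal u) (w : List A) :
    (bb u w.reverse).card = (bb u w).card := by
  refine Finset.card_nbij' Prod.swap Prod.swap ?_ ?_ ?_ ?_
  · intro p hp; simp only [Finset.mem_coe, mem_bb] at hp ⊢; simpa using hc _ hp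
  · intro p hp; simp only [Finset.mem_coe, mem_bb] at hp ⊢; simpa using hc _ hp
  · intro p _; simp
  · intro p _; simp

lemma bo_rev (hc : ClosedUnderReversal u) (w : List A) : bo u w.reverse = bo u w := by
  rw [bo, bo, bb_rev hc, ll_rev hc, rr_rev hc]; ring

lemma bo_zero_of_rr {w : List A} (h : (rr u w).card = 1) : bo u w = 0 := by
  obtain ⟨c, hcc⟩ := Finset.card_eq_one.1 h
  have : (bb u w).card = (ll u w).card := by
    have key : ∀ a b, IsFactor u (a :: (w ++ [b])) → b = c := by
      intro a b hab
      have : b ∈ rr u w := mem_rr.2 (fac_tail hab)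
      rw [hcc] at this; simpa using this
    refine Finset.card_nbij' Prod.fst (fun a => (a, c)) ?_ ?_ ?_ ?_
    · rintro ⟨a, b⟩ hp; simp only [Finset.mem_coe, mem_bb, mem_ll] at hp ⊢
      exact fac_init (w := a :: w) (b := b) (by simpa using hp)
    · intro a ha; simp only [Finset.mem_coe, mem_bb, mem_ll] at ha ⊢
      obtain ⟨b, hb⟩ := fac_right ha
      have := key a b (by simpa using hb)
      subst this; simpa using hb
    · rintro ⟨a, b⟩ hp; simp only [Finset.mem_coe, mem_bb] at hp
      simp [key a b hp]
    · intro a _; rfl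
  rw [bo, this, h]; push_cast; ring

lemma rr_le (w : List A) : (rr u w).card ≤ Fintype.card A := Finset.card_le_univ _

lemma card_rr (n : ℕ) : (FF u (n+1)).card = ∑ w ∈ FF u n, (rr u w).card := by
  rw [← Finset.card_sigma]
  symm
  refine Finset.card_nbij (fun p => p.1 ++ [p.2]) ?_ ?_ ?_
  · rintro ⟨w, b⟩ h
    simp only [Finset.coe_sigma, Set.mem_sigma_iff, Finset.mem_coe, mem_FF, mem_rr] at h ⊢
    exact ⟨by simp [h.1.1], h.2⟩
  · rintro ⟨w, b⟩ _ ⟨w', b'⟩ _ h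
    have := List.append_inj' h rfl
    simp at this; simp [this]
  · intro v hv
    simp only [Finset.mem_coe, mem_FF] at hv
    obtain ⟨hl, hf⟩ := hv
    rcases List.eq_nil_or_concat v with rfl | ⟨w, b, rfl⟩
    · simp at hl
    · rw [List.concat_eq_append] at *
      refine ⟨⟨w, b⟩, ?_, rfl⟩
      simp only [Finset.coe_sigma, Set.mem_sigma_iff, Finset.mem_coe, mem_FF, mem_rr]
      exact ⟨⟨by simpa using hl, fac_init hf⟩, hf⟩

lemma card_ll (n : ℕ) : (FF u (n+1)).card = ∑ w ∈ FF u n, (ll u w).card := by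
  rw [← Finset.card_sigma]
  symm
  refine Finset.card_nbij (fun p => p.2 :: p.1) ?_ ?_ ?_
  · rintro ⟨w, b⟩ h
    simp only [Finset.coe_sigma, Set.mem_sigma_iff, Finset.mem_coe, mem_FF, mem_ll] at h ⊢
    exact ⟨by simp [h.1.1], h.2⟩
  · rintro ⟨w, b⟩ _ ⟨w', b'⟩ _ h
    simp at h; simp [h]
  · intro v hv
    simp only [Finset.mem_coe, mem_FF] at hv
    obtain ⟨hl, hf⟩ := hv
    rcases v with _ | ⟨b, w⟩
    · simp at hl
    · refine ⟨⟨w, b⟩, ?_, rfl⟩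
      simp only [Finset.coe_sigma, Set.mem_sigma_iff, Finset.mem_coe, mem_FF, mem_ll]
      exact ⟨⟨by simpa using hl, fac_tail hf⟩, hf⟩

lemma exists_both {n : ℕ} {v : List A} (hl : v.length = n + 2) :
    ∃ a w b, v = a :: (w ++ [b]) := by
  rcases v with _ | ⟨a, t⟩
  · simp at hl
  rcases List.eq_nil_or_concat t with rfl | ⟨w, b, rfl⟩
  · simp at hl
  · exact ⟨a, w, b, by simp⟩

lemma card_bb (n : ℕ) : (FF u (n+2)).card = ∑ w ∈ FF u n, (bb u w).card := by
  rw [← Finset.card_sigma]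
  symm
  refine Finset.card_nbij (fun p => p.2.1 :: (p.1 ++ [p.2.2])) ?_ ?_ ?_
  · rintro ⟨w, b⟩ h
    simp only [Finset.coe_sigma, Set.mem_sigma_iff, Finset.mem_coe, mem_FF, mem_bb] at h ⊢
    exact ⟨by simp [h.1.1], h.2⟩
  · rintro ⟨w, a, b⟩ _ ⟨w', a', b'⟩ _ h
    simp only [List.cons.injEq] at h
    have := List.append_inj' h.2 rfl
    simp at this; simp [this, h.1]
  · intro v hv
    simp only [Finset.mem_coe, mem_FF] at hv
    obtain ⟨hl, hf⟩ := hv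
    obtain ⟨a, w, b, rfl⟩ := exists_both hl
    refine ⟨⟨w, a, b⟩, ?_, rfl⟩
    simp only [Finset.coe_sigma, Set.mem_sigma_iff, Finset.mem_coe, mem_FF, mem_bb]
    exact ⟨⟨by simpa using hl, fac_init (fac_tail hf)⟩, hf⟩

lemma card_dd (n : ℕ) : (PP u (n+2)).card = ∑ w ∈ PP u n, (dd u w).card := by
  rw [← Finset.card_sigma]
  symm
  refine Finset.card_nbij (fun p => p.2 :: (p.1 ++ [p.2])) ?_ ?_ ?_
  · rintro ⟨w, b⟩ h
    simp only [Finset.coe_sigma, Set.mem_sigma_iff, Finset.mem_coe, mem_PP, mem_dd] at h ⊢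
    exact ⟨by simp [h.1.1], h.2, by simp [h.1.2.2]⟩
  · rintro ⟨w, a⟩ _ ⟨w', a'⟩ _ h
    simp only [List.cons.injEq] at h
    have := List.append_inj' h.2 rfl
    simp at this; simp [this]
  · intro v hv
    simp only [Finset.mem_coe, mem_PP] at hv
    obtain ⟨hl, hf, hp⟩ := hv
    obtain ⟨a, w, b, rfl⟩ := exists_both hl
    simp only [List.reverse_cons, List.reverse_append, List.reverse_nil, List.nil_append,
      List.cons_append, List.cons.injEq] at hp
    obtain ⟨rfl, hp⟩ := hp
    have hp := List.append_inj_left' hp rfl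
    refine ⟨⟨w, b⟩, ?_, rfl⟩
    simp only [Finset.coe_sigma, Set.mem_sigma_iff, Finset.mem_coe, mem_PP, mem_dd]
    exact ⟨⟨by simpa using hl, fac_init (fac_tail hf), hp⟩, hf⟩

lemma sum_bo (n : ℕ) : ∑ w ∈ FF u n, bo u w =
    ((FF u (n+2)).card : ℤ) - 2 * (FF u (n+1)).card + (FF u n).card := by
  simp only [bo, Finset.sum_add_distrib, Finset.sum_sub_distrib, Finset.sum_const]
  have h1 := card_bb (u := u) n
  have h2 := card_rr (u := u) n
  have h3 := card_ll (u := u) n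
  zify at h1 h2 h3
  rw [← h1, ← h2, ← h3]; simp; ring

/-! ### Upper bound -/

open Classical in
lemma upper_aux (hc : ClosedUnderReversal u) (n N : ℕ) :
    ∃ V E : Finset (List A),
      (∀ w, w ∈ V ↔ ∃ i ≤ N, w = word u i n ∨ w = (word u i n).reverse) ∧
      (∀ e ∈ E, e.reverse ≠ e ∧ ∃ i < N, e = word u i (n+1) ∨ e = (word u i (n+1)).reverse) ∧
      V.card + (V.filter (fun w => w.reverse = w)).card ≤ E.card + 2 := by
  induction N with
  | zero =>
    refine ⟨{word u 0 n, (word u 0 n).reverse}, ∅, ?_, by simp, ?_⟩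
    · intro w; simp
    · by_cases h : (word u 0 n).reverse = word u 0 n
      · simp [h, Finset.filter_singleton]
      · have h' : ¬ (word u 0 n) = (word u 0 n).reverse := fun h2 => h h2.symm
        rw [Finset.card_pair h']
        simp [Finset.filter_insert, Finset.filter_singleton, h, h']
  | succ N ih =>
    obtain ⟨V, E, hV, hE, hcard⟩ := ih
    set x := word u (N+1) n with hx
    set e := word u N (n+1) with he
    by_cases hxV : x ∈ V
    · refine ⟨V, E, ?_, ?_, hcard⟩
      · intro w
        rw [hV]
        constructor
        · rintro ⟨i, hi, h⟩; exact ⟨i, by omega, h⟩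
        · rintro ⟨i, hi, h⟩
          rcases Nat.lt_or_ge N i with h1 | h1
          · obtain rfl : i = N + 1 := by omega
            obtain ⟨j, hj, hj'⟩ := (hV x).1 hxV
            refine ⟨j, hj, ?_⟩
            rw [← hx] at h
            rcases h with rfl | rfl <;> rcases hj' with h2 | h2 <;> simp [h2]
          · exact ⟨i, h1, h⟩
      · intro e he
        obtain ⟨h1, i, hi, h2⟩ := hE e he
        exact ⟨h1, i, by omega, h2⟩
    · have hxr : x.reverse ∉ V := by
        intro h
        apply hxV
        rw [hV] at h ⊢
        obtain ⟨j, hj, hj'⟩ := h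
        refine ⟨j, hj, ?_⟩
        rcases hj' with h2 | h2
        · right; rw [← h2]; simp
        · left; simpa using h2
      have hsx : e = u N :: x := word_succ' N n
      have hepal : e.reverse ≠ e := by
        intro h
        apply hxV
        rw [hV]
        refine ⟨N, le_rfl, Or.inr ?_⟩
        have h1 : e = word u N n ++ [u (N+n)] := word_succ N n
        rw [hsx] at h
        rw [← hsx, h1] at h
        simp only [List.reverse_append, List.reverse_cons, List.reverse_nil, List.nil_append,
          List.cons_append] at h
        rw [← h1, hsx] at h
        exact (List.cons.inj h).2.symm
      have hnot : ∀ i < N, e ≠ word u i (n+1) ∧ e ≠ (word u i (n+1)).reverse := by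
        intro i hi
        refine ⟨fun h => hxV ((hV x).2 ⟨i+1, by omega, Or.inl ?_⟩),
          fun h => hxV ((hV x).2 ⟨i, by omega, Or.inr ?_⟩)⟩
        · rw [hsx, word_succ'] at h
          exact (List.cons.inj h).2
        · rw [hsx, word_succ] at h
          simp only [List.reverse_append, List.reverse_cons, List.reverse_nil, List.nil_append,
            List.cons_append] at h
          exact (List.cons.inj h).2
      have heE : e ∉ E := by
        intro h
        obtain ⟨_, i, hi, h2⟩ := hE e h
        rcases h2 with h2 | h2
        · exact (hnot i hi).1 h2
        · exact (hnot i hi).2 h2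
      have herE : e.reverse ∉ E := by
        intro h
        obtain ⟨_, i, hi, h2⟩ := hE _ h
        rcases h2 with h2 | h2
        · exact (hnot i hi).2 (by rw [← h2]; simp)
        · exact (hnot i hi).1 (by simpa using h2)
      refine ⟨insert x (insert x.reverse V), insert e (insert e.reverse E), ?_, ?_, ?_⟩
      · intro w
        simp only [Finset.mem_insert, hV]
        constructor
        · rintro (h | h | ⟨i, hi, h⟩)
          · exact ⟨N+1, le_rfl, Or.inl h⟩
          · exact ⟨N+1, le_rfl, Or.inr h⟩
          · exact ⟨i, by omega, h⟩
        · rintro ⟨i, hi, h⟩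
          rcases Nat.lt_or_ge N i with h1 | h1
          · obtain rfl : i = N + 1 := by omega
            tauto
          · exact Or.inr (Or.inr ⟨i, h1, h⟩)
      · intro f hf
        simp only [Finset.mem_insert] at hf
        rcases hf with rfl | rfl | hf
        · exact ⟨hepal, N, by omega, Or.inl rfl⟩
        · exact ⟨fun h => hepal (by simpa using h.symm), N, by omega, Or.inr rfl⟩
        · obtain ⟨h1, i, hi, h2⟩ := hE f hf
          exact ⟨h1, i, by omega, h2⟩
      · have hEc : (insert e (insert e.reverse E)).card = E.card + 2 := by
          rw [Finset.card_insert_of_notMem, Finset.card_insert_of_notMem herE]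
          simp [heE, Ne.symm hepal]
        rw [hEc]
        by_cases hp : x.reverse = x
        · rw [hp, Finset.insert_idem, Finset.filter_insert, if_pos hp,
            Finset.card_insert_of_notMem hxV, Finset.card_insert_of_notMem (by simp [hxV])]
          omega
        · have hp' : ¬ (x = x.reverse) := fun h => hp h.symm
          rw [Finset.filter_insert, if_neg hp, Finset.filter_insert,
            if_neg (by simpa using hp'), Finset.card_insert_of_notMem,
            Finset.card_insert_of_notMem hxr]
          · omega
          · simp [hxV, hp']

open Classical in
lemma upper (hc : ClosedUnderReversal u) (n : ℕ) :
    (FF u n).card + (PP u n).card + (PP u (n+1)).card ≤ (FF u (n+1)).card + 2 := by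
  have hN : ∃ N, ∀ w ∈ FF u n, ∃ i ≤ N, w = word u i n := by
    have : ∀ w : List A, ∃ i, w ∈ FF u n → w = word u i n := by
      intro w
      by_cases h : w ∈ FF u n
      · obtain ⟨hl, hf⟩ := mem_FF.1 h
        obtain ⟨i, hi⟩ := isFactor_iff.1 hf
        exact ⟨i, fun _ => by rw [← hl, hi]⟩
      · exact ⟨0, fun h' => absurd h' h⟩
    choose f hf using this
    exact ⟨(FF u n).sup f, fun w hw => ⟨f w, Finset.le_sup hw, hf w hw⟩⟩
  obtain ⟨N, hN⟩ := hN
  obtain ⟨V, E, hV, hE, h⟩ := upper_aux hc n N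
  have hVF : V = FF u n := by
    ext w
    rw [hV]
    constructor
    · rintro ⟨i, _, rfl | rfl⟩
      · exact mem_FF.2 ⟨word_length _ _, isFactor_word _ _⟩
      · exact mem_FF.2 ⟨by simp [word_length], hc _ (isFactor_word _ _)⟩
    · intro hw
      obtain ⟨i, hi, h⟩ := hN w hw
      exact ⟨i, hi, Or.inl h⟩
  have hEF : E ⊆ (FF u (n+1)).filter (fun w => ¬ w.reverse = w) := by
    intro e he
    obtain ⟨h1, i, _, h2⟩ := hE e he
    rw [Finset.mem_filter]
    refine ⟨?_, h1⟩
    rcases h2 with rfl | rfl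
    · exact mem_FF.2 ⟨word_length _ _, isFactor_word _ _⟩
    · exact mem_FF.2 ⟨by simp [word_length], hc _ (isFactor_word _ _)⟩
  have h3 := Finset.card_le_card hEF
  have h4 := Finset.card_filter_add_card_filter_not (s := FF u (n+1)) (fun w => w.reverse = w)
  rw [hVF] at h
  simp only [PP]
  omega

/-! ### Local inequality -/

lemma bool_ineq : ∀ a b c x y z : Bool,
    let s := (a || x || y).toNat + (x || b || z).toNat + (y || z || c).toNat
    let B := a.toNat + b.toNat + c.toNat + 2 * (x.toNat + y.toNat + z.toNat)
    1 ≤ s → (s = 3 → B = 5) → B + 2 ≤ (a.toNat + b.toNat + c.toNat) + 2 * s := by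
  decide

open Classical in
lemma local_ineq (hA : Fintype.card A = 3) (hc : ClosedUnderReversal u) {w : List A}
    (hf : IsFactor u w) (hp : w.reverse = w)
    (h3 : (rr u w).card = 3 → (bb u w).card = 5) :
    (bb u w).card + 2 ≤ (dd u w).card + 2 * (rr u w).card := by
  have e : Fin 3 ≃ A := (Fintype.equivFinOfCardEq hA).symm
  set M : Fin 3 → Fin 3 → Bool := fun i j => decide (IsFactor u (e i :: (w ++ [e j]))) with hM
  have hsym : ∀ i j, M i j = M j i := by
    intro i j
    simp only [hM, decide_eq_decide]
    rw [← fac_rev hc]; simp [hp]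
  have hMv : ∀ i j, (if IsFactor u (e i :: (w ++ [e j])) then 1 else 0) = (M i j).toNat := by
    intro i j
    simp only [hM]
    split_ifs with h <;> simp [h]
  have hRv : ∀ j, (if IsFactor u (w ++ [e j]) then 1 else 0)
      = (M 0 j || M 1 j || M 2 j).toNat := by
    intro j
    split_ifs with h
    · obtain ⟨a, ha⟩ := fac_left hc h
      obtain ⟨i, rfl⟩ := e.surjective a
      have hi : M i j = true := by simp only [hM, decide_eq_true_eq]; exact ha
      fin_cases i <;> simp_all
    · have : ∀ i, M i j = false := by
        intro i
        simp only [hM, decide_eq_false_iff_not]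
        exact fun hh => h (fac_tail hh)
      simp [this]
  have hR : (rr u w).card = (M 0 0 || M 0 1 || M 0 2).toNat + (M 0 1 || M 1 1 || M 1 2).toNat
      + (M 0 2 || M 1 2 || M 2 2).toNat := by
    rw [rr, Finset.card_filter, ← Equiv.sum_comp e, Fin.sum_univ_three, hRv, hRv, hRv,
      hsym 1 0, hsym 2 0, hsym 2 1]
  have hD : (dd u w).card = (M 0 0).toNat + (M 1 1).toNat + (M 2 2).toNat := by
    rw [dd, Finset.card_filter, ← Equiv.sum_comp e, Fin.sum_univ_three, hMv, hMv, hMv]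
  have hB : (bb u w).card = (M 0 0).toNat + (M 1 1).toNat + (M 2 2).toNat +
      2 * ((M 0 1).toNat + (M 0 2).toNat + (M 1 2).toNat) := by
    rw [bb, Finset.card_filter, Fintype.sum_prod_type, ← Equiv.sum_comp e]
    simp only [← Equiv.sum_comp e (fun x => ite (IsFactor u (_ :: (w ++ [x]))) 1 0),
      Fin.sum_univ_three, hMv]
    rw [hsym 1 0, hsym 2 0, hsym 2 1]
    ring
  have h1 := rr_pos hf
  rw [hR] at h1
  rw [hB, hR] at h3
  rw [hB, hR, hD]
  exact bool_ineq _ _ _ _ _ _ h1 h3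

/-! ### Main arguments -/

lemma sub_sum_le {n : ℕ} (hC : (FF u (n+1)).card = (FF u n).card + 2) (T : Finset (List A))
    (hT : T ⊆ FF u n) : ∑ w ∈ T, (((rr u w).card : ℤ) - 1) ≤ 2 := by
  have h1 : ∑ w ∈ FF u n, (((rr u w).card : ℤ) - 1) = 2 := by
    rw [Finset.sum_sub_distrib]
    have := card_rr (u := u) n
    zify at this hC
    rw [← this, hC]; simp
  rw [← h1]
  refine Finset.sum_le_sum_of_subset_of_nonneg hT ?_
  intro w hw _
  have := rr_pos (mem_FF.1 hw).2
  omega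

open Classical in
lemma pal_mono (hA : Fintype.card A = 3) (hc : ClosedUnderReversal u) (n : ℕ)
    (hC : (FF u (n+1)).card = (FF u n).card + 2)
    (hC2 : (FF u (n+2)).card = (FF u (n+1)).card + 2) :
    (PP u n).card ≤ (PP u (n+2)).card := by
  have hsum : ∑ w ∈ FF u n, bo u w = 0 := by
    rw [sum_bo]; omega
  have hnon : ∀ w ∈ FF u n, w ∉ PP u n → bo u w = 0 := by
    intro w hw hwp
    by_contra hb
    obtain ⟨hl, hf⟩ := mem_FF.1 hw
    have hne : w ≠ w.reverse := fun h => hwp (mem_PP.2 ⟨hl, hf, h.symm⟩)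
    have hw' : w.reverse ∈ FF u n := mem_FF.2 ⟨by simpa using hl, hc _ hf⟩
    have r1 : 2 ≤ (rr u w).card := by
      have := rr_pos hf
      have : (rr u w).card ≠ 1 := fun h => hb (bo_zero_of_rr h)
      omega
    have r2 : 2 ≤ (rr u w.reverse).card := by
      have := rr_pos (hc _ hf)
      have : (rr u w.reverse).card ≠ 1 := fun h => hb (by rw [← bo_rev hc]; exact bo_zero_of_rr h)
      omega
    have hoth : ∀ x ∈ FF u n, x ∉ ({w, w.reverse} : Finset (List A)) → bo u x = 0 := by
      intro x hx hxn
      apply bo_zero_of_rr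
      have h1 := sub_sum_le hC (insert x {w, w.reverse}) (by
        intro y hy
        simp only [Finset.mem_insert, Finset.mem_singleton] at hy
        rcases hy with rfl | rfl | rfl <;> assumption)
      rw [Finset.sum_insert hxn, Finset.sum_pair hne] at h1
      have := rr_pos (mem_FF.1 hx).2
      omega
    have h2 := Finset.sum_subset (f := bo u) (s₁ := {w, w.reverse}) (s₂ := FF u n) (by
        intro y hy
        simp only [Finset.mem_insert, Finset.mem_singleton] at hy
        rcases hy with rfl | rfl <;> assumption) hoth
    rw [Finset.sum_pair hne, hsum, bo_rev hc] at h2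
    omega
  have hPF : PP u n ⊆ FF u n := Finset.filter_subset _ _
  have hpsum : ∑ w ∈ PP u n, bo u w = 0 := by
    rw [Finset.sum_subset hPF hnon, hsum]
  have hineq : ∀ w ∈ PP u n, bo u w + 1 ≤ ((dd u w).card : ℤ) := by
    intro w hw
    obtain ⟨hl, hf, hp⟩ := mem_PP.1 hw
    have hL : ll u w = rr u w := by
      have := ll_rev hc w
      rwa [hp] at this
    have h3 : (rr u w).card = 3 → (bb u w).card = 5 := by
      intro h3
      have hz : bo u w = 0 := by
        rw [← hsum]
        symm
        apply Finset.sum_eq_single_of_mem w (hPF hw)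
        intro x hx hxw
        apply bo_zero_of_rr
        have h1 := sub_sum_le hC {x, w} (by
          intro y hy
          simp only [Finset.mem_insert, Finset.mem_singleton] at hy
          rcases hy with rfl | rfl
          · exact hx
          · exact hPF hw)
        rw [Finset.sum_pair hxw] at h1
        have := rr_pos (mem_FF.1 hx).2
        omega
      rw [bo, hL, h3] at hz
      omega
    have := local_ineq hA hc hf hp h3
    rw [bo, hL]
    omega
  have h := Finset.sum_le_sum hineq
  rw [Finset.sum_add_distrib, hpsum] at h
  have h5 := card_dd (u := u) n
  zify at h5
  rw [← h5] at h
  simp at h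
  exact h

lemma FF_zero : (FF u 0).card = 1 := by
  rw [Finset.card_eq_one]
  refine ⟨[], ?_⟩
  ext w
  simp only [mem_FF, Finset.mem_singleton, List.length_eq_zero_iff]
  constructor
  · exact fun h => h.1
  · rintro rfl
    exact ⟨rfl, 0, by simp [OccursAt, word]⟩

lemma PP_zero : (PP u 0).card = 1 := by
  rw [Finset.card_eq_one]
  refine ⟨[], ?_⟩
  ext w
  simp only [mem_PP, Finset.mem_singleton, List.length_eq_zero_iff]
  constructor
  · exact fun h => h.1
  · rintro rfl
    exact ⟨rfl, ⟨0, by simp [OccursAt, word]⟩, rfl⟩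

lemma FF_one (hA : Fintype.card A = 3) (hall : AllLettersOccur u) : (FF u 1).card = 3 := by
  rw [← hA, ← Finset.card_univ]
  symm
  refine Finset.card_nbij (fun a => [a]) ?_ ?_ ?_
  · intro a _
    obtain ⟨i, hi⟩ := hall a
    exact mem_FF.2 ⟨rfl, i, by simp [OccursAt, word, hi]⟩
  · intro a _ b _ h
    simpa using h
  · intro v hv
    obtain ⟨a, rfl⟩ := List.length_eq_one_iff.1 (mem_FF.1 hv).1
    exact ⟨a, by simp, rfl⟩

lemma PP_one : PP u 1 = FF u 1 := by
  ext w
  rw [mem_PP, mem_FF]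
  constructor
  · exact fun h => ⟨h.1, h.2.1⟩
  · rintro ⟨h, h2⟩
    refine ⟨h, h2, ?_⟩
    obtain ⟨a, rfl⟩ := List.length_eq_one_iff.1 h
    rfl

lemma part1 (hA : Fintype.card A = 3) (hall : AllLettersOccur u) (hc : ClosedUnderReversal u)
    (hC : ∀ n, (FF u n).card = 2 * n + 1) (n : ℕ) :
    (PP u n).card + (PP u (n+1)).card = 4 := by
  have hup := upper hc n
  rw [hC, hC] at hup
  have hlow : 4 ≤ (PP u n).card + (PP u (n+1)).card := by
    clear hup
    induction n with
    | zero => rw [PP_zero, PP_one, FF_one hA hall]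
    | succ n ih =>
      have := pal_mono hA hc n (by rw [hC, hC]; ring) (by rw [hC, hC]; ring)
      rw [show n + 1 + 1 = n + 2 from rfl]
      omega
  omega

lemma part2 (hA : Fintype.card A = 3) (hall : AllLettersOccur u) (hc : ClosedUnderReversal u)
    (hb : ∀ w, IsFactor u w → bo u w = 0) (w : List A) (hf : IsFactor u w) (hp : w.reverse = w) :
    (dd u w).card = 1 := by
  have hC : ∀ n, (FF u n).card = 2 * n + 1 ∧ (FF u (n+1)).card = 2 * (n + 1) + 1 := by
    intro n
    induction n with
    | zero => exact ⟨FF_zero, FF_one hA hall⟩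
    | succ n ih =>
      refine ⟨ih.2, ?_⟩
      have h := sum_bo (u := u) n
      rw [Finset.sum_eq_zero (fun w hw => hb w (mem_FF.1 hw).2)] at h
      rw [show n + 1 + 1 = n + 2 from rfl]
      omega
  have h1 := part1 hA hall hc (fun n => (hC n).1) w.length
  have h2 := part1 hA hall hc (fun n => (hC n).1) (w.length + 1)
  rw [show w.length + 1 + 1 = w.length + 2 from rfl, card_dd] at h2
  have hge : ∀ v ∈ PP u w.length, 1 ≤ (dd u v).card := by
    intro v hv
    obtain ⟨hl, hf, hp⟩ := mem_PP.1 hv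
    have hL : ll u v = rr u v := by
      have := ll_rev hc v
      rwa [hp] at this
    have hz := hb v hf
    rw [bo, hL] at hz
    have := local_ineq hA hc hf hp (by intro h; rw [h] at hz; omega)
    omega
  have hs : ∑ v ∈ PP u w.length, 1 = ∑ v ∈ PP u w.length, (dd u v).card := by
    simp only [Finset.sum_const, smul_eq_mul, mul_one]; omega
  exact ((Finset.sum_eq_sum_iff_of_le hge).1 hs w (mem_PP.2 ⟨rfl, hf, hp⟩)).symm

end

/-- For a ternary infinite word with language closed under
reversal: (1) `C(n) = 2n + 1` for all `n` implies `P(n) + P(n+1) = 4` for all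
`n`; (2) if every bispecial factor is ordinary, then every palindromic factor
has exactly one palindromic extension. -/
theorem stmt15 {A : Type*} [Fintype A] (u : ℕ → A)
    (hcard : Fintype.card A = 3)
    (hall : AllLettersOccur u)
    (hcur : ClosedUnderReversal u) :
    ((∀ n : ℕ, complexity u n = 2 * n + 1) →
      ∀ n : ℕ, palComplexity u n + palComplexity u (n + 1) = 4) ∧
    ((∀ w : List A, Bispecial u w → bilateralOrder u w = 0) →
      ∀ w : List A, IsFactor u w → w.reverse = w →
        Set.ncard (Pext u w) = 1) := by
  refine ⟨fun hC n => ?_, fun hb w hf hp => ?_⟩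
  · rw [palComplexity_eq, palComplexity_eq]
    exact part1 hcard hall hcur (fun n => by rw [← complexity_eq, hC]) n
  · rw [Pext_eq]
    refine part2 hcard hall hcur (fun v hv => ?_) w hf hp
    have h1 := rr_pos hv
    have h2 := rr_pos (hcur _ hv)
    rw [rr_rev hcur] at h2
    by_cases hr : (rr u v).card = 1
    · exact bo_zero_of_rr hr
    by_cases hl : (ll u v).card = 1
    · rw [← bo_rev hcur]
      exact bo_zero_of_rr (by rw [rr_rev hcur]; exact hl)
    rw [← bo_eq]
    exact hb v ⟨hv, by rw [Lext_eq]; omega, by rw [Rext_eq]; omega⟩
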